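/- arXiv:2310.05043 — 2 statements merged into one kernel-verified Lean document; each statement's English description precedes it below -/
import Mathlib

section
/- Let κ and λ be infinite regular cardinals with λ ≤ κ. Then every λ-ultrametric space X of weight at most κ is homeomorphic to a subspace of κ^λ, where κ^λ denotes the set of functions from λ to κ equipped with the topology induced by the λ-ultrametric u(a,b) = sup{α < λ : a↾α = b↾α}. -/
open Set Function

universe u v

/-- The closed ball of radius `α` and center `x` in an ordinal-valued ultrametric space:
`B_α(x) = {y | u x y ≥ α}`. -/
def Ball {X : Type u} (u : X → X → Ordinal) (α : Ordinal) (x : X) : Set X :=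
  {y | α ≤ u x y}

/-- `u` is a `γ`-ultrametric on `X`: it takes values in `γ + 1` (i.e. values `≤ γ`),
`u x y = γ` iff `x = y`, the ultrametric triangle law, and symmetry. -/
structure IsUltrametric {X : Type u} (γ : Ordinal) (u : X → X → Ordinal) : Prop where
  le_gamma : ∀ x y, u x y ≤ γ
  eq_gamma_iff : ∀ x y, u x y = γ ↔ x = y
  triangle : ∀ x y z, min (u y x) (u x z) ≤ u y z
  symm : ∀ x y, u x y = u y x

/-- The topology induced by a `γ`-ultrametric: the closed balls `B_α(x)`, `α < γ`,
form a base. -/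
def ballTopology {X : Type u} (γ : Ordinal) (u : X → X → Ordinal) : TopologicalSpace X :=
  TopologicalSpace.generateFrom {s : Set X | ∃ x α, α < γ ∧ s = Ball u α x}

/-- `f` is uniformly continuous from the `γX`-ultrametric space `(X, u)` to the
`γY`-ultrametric space `(Y, d)`. -/
def UnifCont {X : Type u} {Y : Type v} (γX γY : Ordinal)
    (u : X → X → Ordinal) (d : Y → Y → Ordinal) (f : X → Y) : Prop :=
  ∀ ε < γY, ∃ δ < γX, ∀ a b, δ ≤ u a b → ε ≤ d (f a) (f b)

/-- A discrete set regarded as a `γ`-ultrametric space. -/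
noncomputable def discreteUltra {X : Type u} (γ : Ordinal) (a b : X) : Ordinal :=
  @ite _ (a = b) (Classical.propDecidable _) γ 0

/-- `A` is uniformly nowhere dense in the `γ`-ultrametric space `(X, u)`. -/
def UnifNwd {X : Type u} (γ : Ordinal) (u : X → X → Ordinal) (A : Set X) : Prop :=
  ∀ α < γ, ∃ β, α < β ∧ β < γ ∧ ∀ b : X, ∃ a ∈ Ball u α b, Ball u β a ∩ A = ∅

/-- The space `κ^λ` of functions from (the ordinals below) `λ` to (the ordinals below) `κ`. -/
def funSpace (κ lam : Cardinal.{0}) : Type 1 :=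
  ↥(Set.Iio lam.ord) → ↥(Set.Iio κ.ord)

/-- The canonical `λ`-ultrametric on `κ^λ`: `u(a,b) = sup {α < λ : a↾α = b↾α}`. -/
noncomputable def funUltra (κ lam : Cardinal.{0}) (a b : funSpace κ lam) : Ordinal :=
  sSup {α : Ordinal | α < lam.ord ∧ ∀ β : ↥(Set.Iio lam.ord), (β : Ordinal) < α → a β = b β}

noncomputable instance (κ lam : Cardinal.{0}) : TopologicalSpace (funSpace κ lam) :=
  ballTopology lam.ord (funUltra κ lam)

/-- The space `X` with topology `t` has weight (least cardinality of a base) at most `c`. -/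
def WeightLE (X : Type u) (t : TopologicalSpace X) (c : Cardinal.{0}) : Prop :=
  ∃ B : Set (Set X), t.IsTopologicalBasis B ∧ Cardinal.mk B ≤ Cardinal.lift.{u} c

theorem IsUltrametric.mem_ball_self {X : Type u} {γ α : Ordinal} {d : X → X → Ordinal}
    (h : IsUltrametric γ d) (hα : α ≤ γ) (x : X) : x ∈ Ball d α x := by
  change α ≤ d x x
  rwa [(h.eq_gamma_iff x x).2 rfl]

theorem IsUltrametric.le_trans {X : Type u} {γ α : Ordinal} {d : X → X → Ordinal}
    (h : IsUltrametric γ d) {x y z : X} (hxy : α ≤ d x y) (hyz : α ≤ d y z) : α ≤ d x z :=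
  (le_min hxy hyz).trans (h.triangle y x z)

theorem IsUltrametric.ball_eq_of_mem {X : Type u} {γ α : Ordinal} {d : X → X → Ordinal}
    (h : IsUltrametric γ d) {x y : X} (hxy : y ∈ Ball d α x) : Ball d α x = Ball d α y := by
  have hxy' : α ≤ d x y := hxy
  have hyx : α ≤ d y x := h.symm x y ▸ hxy'
  exact Set.ext fun z => ⟨fun hz => h.le_trans hyx hz, fun hz => h.le_trans hxy' hz⟩

theorem isOpen_ball {X : Type u} {γ α : Ordinal} (d : X → X → Ordinal) (hα : α < γ) (x : X) :
    (ballTopology γ d).IsOpen (Ball d α x) :=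
  TopologicalSpace.isOpen_generateFrom_of_mem ⟨x, α, hα, rfl⟩

theorem le_funUltra_iff {κ lam : Cardinal.{0}} {α : Ordinal} (hα : α < lam.ord)
    (a b : funSpace κ lam) :
    α ≤ funUltra κ lam a b ↔
      ∀ β : ↥(Set.Iio lam.ord), (β : Ordinal) < α → a β = b β := by
  constructor
  · intro h β hβ
    have hne : {α : Ordinal | α < lam.ord ∧ ∀ β : ↥(Set.Iio lam.ord),
        (β : Ordinal) < α → a β = b β}.Nonempty :=
      ⟨0, bot_le.trans_lt hα, fun _ h => absurd h not_lt_bot⟩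
    obtain ⟨δ, hδ, hβδ⟩ := exists_lt_of_lt_csSup hne (hβ.trans_le h)
    exact hδ.2 β hβδ
  · intro h
    exact le_csSup ⟨lam.ord, fun _ hδ => hδ.1.le⟩ ⟨hα, h⟩

/-- In a space of weight at most `κ`, the balls of a fixed radius can be labelled by the
ordinals below `κ`. -/
theorem IsUltrametric.exists_ball_labelling {X : Type u} {γ α : Ordinal} {d : X → X → Ordinal}
    (h : IsUltrametric γ d) (hα : α < γ) {κ : Cardinal.{0}}
    (hw : WeightLE X (ballTopology γ d) κ) :
    ∃ c : X → ↥(Set.Iio κ.ord), ∀ x y, c x = c y ↔ α ≤ d x y := by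
  obtain ⟨B, hB, hcard⟩ := hw
  have hlabel : Nonempty (B ↪ ↥(Set.Iio κ.ord)) := by
    rw [← Cardinal.lift_mk_le', Cardinal.mk_Iio_ordinal, Cardinal.card_ord]
    simpa using Cardinal.lift_le.{1}.2 hcard
  obtain ⟨i⟩ := hlabel
  have hbase : ∀ s : Set.range (Ball d α), ∃ b : B, (b : Set X).Nonempty ∧ (b : Set X) ⊆ s := by
    rintro ⟨_, x, rfl⟩
    obtain ⟨b, hb, hxb, hbs⟩ := (@TopologicalSpace.IsTopologicalBasis.exists_subset_of_mem_open
      X (ballTopology γ d) B hB x _ (h.mem_ball_self hα.le x) (isOpen_ball d hα x))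
    exact ⟨⟨b, hb⟩, ⟨x, hxb⟩, hbs⟩
  choose p hp hps using hbase
  refine ⟨fun x => i (p ⟨Ball d α x, x, rfl⟩), fun x y => ⟨fun hxy => ?_, fun hxy => ?_⟩⟩
  · have hxy := i.injective hxy
    obtain ⟨z, hz⟩ := hp ⟨Ball d α x, x, rfl⟩
    have hxz : α ≤ d x z := hps _ hz
    rw [hxy] at hz
    have hyz : α ≤ d y z := hps _ hz
    exact h.le_trans hxz (h.symm y z ▸ hyz)
  · have hball : Ball d α x = Ball d α y := h.ball_eq_of_mem hxy
    simp only [hball]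

/-- A map preserving every relation `α ≤ d x y` with `α < γ` is an embedding. -/
theorem IsUltrametric.isEmbedding_of_le_iff {X : Type u} {Y : Type v} {γ : Ordinal}
    {d : X → X → Ordinal} {e : Y → Y → Ordinal} (h : IsUltrametric γ d) (hγ : Order.IsSuccLimit γ)
    (he : ∀ α < γ, ∀ a b c, α ≤ e a b → α ≤ e b c → α ≤ e a c) (f : X → Y)
    (hf : ∀ α < γ, ∀ x y, α ≤ e (f x) (f y) ↔ α ≤ d x y) :
    @Topology.IsEmbedding X Y (ballTopology γ d) (ballTopology γ e) f := by
  let := ballTopology γ d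
  let := ballTopology γ e
  refine ⟨⟨?_⟩, fun x y hxy => ?_⟩
  · apply le_antisymm
    · rw [← continuous_iff_le_induced]
      refine continuous_generateFrom_iff.2 ?_
      rintro _ ⟨b, α, hα, rfl⟩
      have hunion : f ⁻¹' Ball e α b = ⋃ x ∈ f ⁻¹' Ball e α b, Ball d α x := by
        ext y
        simp only [Set.mem_iUnion, exists_prop]
        constructor
        · exact fun hy => ⟨y, hy, h.mem_ball_self hα.le y⟩
        · rintro ⟨x, hx, hxy⟩
          have hbx : α ≤ e b (f x) := hx
          exact he α hα _ _ _ hbx ((hf α hα x y).2 hxy)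
      rw [hunion]
      exact isOpen_biUnion fun x _ => isOpen_ball d hα x
    · refine le_generateFrom ?_
      rintro _ ⟨x, α, hα, rfl⟩
      exact ⟨Ball e α (f x), isOpen_ball e hα (f x), Set.ext fun y => hf α hα x y⟩
  · refine (h.eq_gamma_iff x y).1 (le_antisymm (h.le_gamma x y) ?_)
    refine hγ.le_iff_forall_le.2 fun α hα => ?_
    rw [← hf α hα, hxy, hf α hα]
    exact h.mem_ball_self hα.le y

theorem stmt9 (κ lam : Cardinal.{0}) (hκ : κ.IsRegular) (hlam : lam.IsRegular)
    (hle : lam ≤ κ)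
    (X : Type u) (uX : X → X → Ordinal) (hX : IsUltrametric lam.ord uX)
    (hw : WeightLE X (ballTopology lam.ord uX) κ) :
    ∃ f : X → funSpace κ lam,
      @Topology.IsEmbedding X (funSpace κ lam) (ballTopology lam.ord uX)
        (ballTopology lam.ord (funUltra κ lam)) f := by
  have hlim : Order.IsSuccLimit lam.ord := Cardinal.isSuccLimit_ord hlam.aleph0_le
  have hsucc (β : ↥(Set.Iio lam.ord)) : Order.succ (β : Ordinal) < lam.ord := hlim.succ_lt β.2
  choose c hc using fun β => hX.exists_ball_labelling (hsucc β) hw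
  refine ⟨fun x β => c β x, hX.isEmbedding_of_le_iff hlim ?_ _ ?_⟩
  · intro α hα a b c hab hbc
    rw [le_funUltra_iff hα] at *
    exact fun β hβ => (hab β hβ).trans (hbc β hβ)
  · intro α hα x y
    refine (le_funUltra_iff hα _ _).trans ?_
    simp only [hc, Order.succ_le_iff]
    exact ⟨fun h => le_of_forall_lt fun β hβ => h ⟨β, hβ.trans hα⟩ hβ,
      fun h β hβ => hβ.trans_le h⟩
end

section
/- Let κ be a weakly compact cardinal and endow 2^κ with the topology induced by the κ-ultrametric u(a,b) = sup{α < κ : a↾α = b↾α}. Let K and L be closed nowhere dense subsets of 2^κ and let h : K → L be a homeomorphism. Then there exists a homeomorphism H : 2^κ → 2^κ such that H(x) = h(x) for every x ∈ K. -/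
open Set Function

universe u v

/-- The generalized Cantor space `2^κ` of functions from (the ordinals below) `κ` to `{0,1}`. -/
def cantor (κ : Cardinal.{0}) : Type 1 := ↥(Set.Iio κ.ord) → Bool

/-- The canonical `κ`-ultrametric on `2^κ`: `u(a,b) = sup {α < κ : a↾α = b↾α}`. -/
noncomputable def cantorUltra (κ : Cardinal.{0}) (a b : cantor κ) : Ordinal :=
  sSup {α : Ordinal | α < κ.ord ∧ ∀ β : ↥(Set.Iio κ.ord), (β : Ordinal) < α → a β = b β}

noncomputable instance (κ : Cardinal.{0}) : TopologicalSpace (cantor κ) :=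
  ballTopology κ.ord (cantorUltra κ)

/-- `κ` is weakly compact: it is uncountable and has the Ramsey property `κ → (κ)²`. -/
def WeaklyCompact (κ : Cardinal.{0}) : Prop :=
  Cardinal.aleph0 < κ ∧
  ∀ f : ↥(Set.Iio κ.ord) → ↥(Set.Iio κ.ord) → Bool,
    ∃ (i : Bool) (A : Set ↥(Set.Iio κ.ord)), Cardinal.mk A = Cardinal.lift.{1} κ ∧
      ∀ a ∈ A, ∀ b ∈ A, a < b → f a b = i

/-- A space is `κ`-compact if every open cover has a subcover of size `< κ`. -/
def KappaCompact (X : Type u) (t : TopologicalSpace X) (κ : Cardinal.{0}) : Prop :=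
  ∀ C : Set (Set X), (∀ s ∈ C, t.IsOpen s) → ⋃₀ C = Set.univ →
    ∃ D ⊆ C, Cardinal.mk D < Cardinal.lift.{u} κ ∧ ⋃₀ D = Set.univ

/-- A bijection extending a partial one: if the complements of the images of two families with the
same kernel are equinumerous, then some permutation carries one family to the other. -/
theorem exists_perm_apply_eq {A Q : Type*} (u v : Q → A) (huv : ∀ q q', u q = u q' ↔ v q = v q')
    (e : Nonempty (↥(range u)ᶜ ≃ ↥(range v)ᶜ)) : ∃ E : Equiv.Perm A, ∀ q, E (u q) = v q := by
  classical
  obtain ⟨e⟩ := e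
  let r : range u → range v := fun a => ⟨v a.2.choose, mem_range_self _⟩
  have hr : ∀ q, r ⟨u q, mem_range_self q⟩ = ⟨v q, mem_range_self q⟩ := fun q =>
    Subtype.ext ((huv _ _).1 (mem_range_self (f := u) q).choose_spec)
  have hrb : Bijective r := by
    constructor
    · rintro ⟨_, q, rfl⟩ ⟨_, q', rfl⟩ h
      rw [hr, hr] at h
      exact Subtype.ext ((huv _ _).2 (congrArg Subtype.val h))
    · rintro ⟨_, q, rfl⟩
      exact ⟨⟨u q, mem_range_self q⟩, hr q⟩
  refine ⟨(Equiv.Set.sumCompl (range u)).symm.trans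
    ((Equiv.sumCongr (Equiv.ofBijective r hrb) e).trans (Equiv.Set.sumCompl (range v))),
    fun q => ?_⟩
  simp [Equiv.Set.sumCompl_symm_apply_of_mem (mem_range_self (f := u) q), hr]

/-- Two families in a product over a well-order that branch in the same way, with equinumerous
sets of nodes omitted at each stage, are matched by a level-preserving permutation. -/
theorem exists_level_preserving_perm {ι Q : Type*} [LinearOrder ι] [WellFoundedLT ι]
    {A : ι → Type*} (u v : Q → ∀ i, A i)
    (huv : ∀ i q q', (∀ j ≤ i, u q j = u q' j) ↔ ∀ j ≤ i, v q j = v q' j)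
    (hcompl : ∀ i q, Nonempty
      (↥(range fun q' : {q' // ∀ j < i, u q' j = u q j} => u q' i)ᶜ ≃
        ↥(range fun q' : {q' // ∀ j < i, v q' j = v q j} => v q' i)ᶜ)) :
    ∃ H : (∀ i, A i) ≃ (∀ i, A i), (∀ q, H (u q) = v q) ∧
      ∀ i x y, (∀ j < i, x j = y j) ↔ ∀ j < i, H x j = H y j := by
  have huv' : ∀ i q q', (∀ j < i, u q j = u q' j) ↔ ∀ j < i, v q j = v q' j := by
    intro i q q'
    constructor
    · intro h j hj
      exact (huv j q q').1 (fun l hl => h l (hl.trans_lt hj)) j le_rfl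
    · intro h j hj
      exact (huv j q q').2 (fun l hl => h l (hl.trans_lt hj)) j le_rfl
  have hE : ∀ (i : ι) (s t : ∀ j, j < i → A j), ∃ E : Equiv.Perm (A i), ∀ q,
      (∀ j hj, u q j = s j hj) → (∀ j hj, v q j = t j hj) → E (u q i) = v q i := by
    intro i s t
    by_cases hq : ∃ q, (∀ j hj, u q j = s j hj) ∧ ∀ j hj, v q j = t j hj
    · obtain ⟨q, hs, ht⟩ := hq
      have hset : (range fun q' : {q' // ∀ j < i, v q' j = v q j} => v q' i) =
          range fun q' : {q' // ∀ j < i, u q' j = u q j} => v q' i := by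
        ext a
        constructor
        · rintro ⟨⟨q', h'⟩, rfl⟩
          exact ⟨⟨q', (huv' i q' q).2 h'⟩, rfl⟩
        · rintro ⟨⟨q', h'⟩, rfl⟩
          exact ⟨⟨q', (huv' i q' q).1 h'⟩, rfl⟩
      obtain ⟨E, hE⟩ := exists_perm_apply_eq
        (fun q' : {q' // ∀ j < i, u q' j = u q j} => u q' i)
        (fun q' : {q' // ∀ j < i, u q' j = u q j} => v q' i) (by
          rintro ⟨a, ha⟩ ⟨b, hb⟩
          have hab : ∀ j < i, u a j = u b j := fun j hj => (ha j hj).trans (hb j hj).symm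
          have hab' := (huv' i a b).1 hab
          constructor
          · intro h
            refine (huv i a b).1 (fun j hj => ?_) i le_rfl
            rcases hj.lt_or_eq with hj | rfl
            exacts [hab j hj, h]
          · intro h
            refine (huv i a b).2 (fun j hj => ?_) i le_rfl
            rcases hj.lt_or_eq with hj | rfl
            exacts [hab' j hj, h]) (hset ▸ hcompl i q)
      exact ⟨E, fun q' hs' _ => hE ⟨q', fun j hj => (hs' j hj).trans (hs j hj).symm⟩⟩
    · exact ⟨Equiv.refl _, fun q hs ht => (hq ⟨q, hs, ht⟩).elim⟩
  choose E hE using hE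
  have wf : WellFounded ((· < ·) : ι → ι → Prop) := wellFounded_lt
  let H : (∀ i, A i) → ∀ i, A i := fun x =>
    wf.fix fun i r => E i (fun j _ => x j) r (x i)
  let G : (∀ i, A i) → ∀ i, A i := fun y =>
    wf.fix fun i r => (E i r (fun j _ => y j)).symm (y i)
  have hH : ∀ x i, H x i = E i (fun j _ => x j) (fun j _ => H x j) (x i) :=
    fun x i => wf.fix_eq _ i
  have hG : ∀ y i, G y i = (E i (fun j _ => G y j) (fun j _ => y j)).symm (y i) :=
    fun y i => wf.fix_eq _ i
  have hGH : ∀ x, G (H x) = x := by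
    intro x
    funext i
    induction i using WellFoundedLT.induction with
    | ind i ih =>
      have h1 : (fun j (_ : j < i) => G (H x) j) = fun j _ => x j :=
        funext fun j => funext fun hj => ih j hj
      rw [hG, h1, hH x i, Equiv.symm_apply_apply]
  have hHG : ∀ y, H (G y) = y := by
    intro y
    funext i
    induction i using WellFoundedLT.induction with
    | ind i ih =>
      have h1 : (fun j (_ : j < i) => H (G y) j) = fun j _ => y j :=
        funext fun j => funext fun hj => ih j hj
      rw [hH, h1, hG y i, Equiv.apply_symm_apply]
  have hHloc : ∀ i x y, (∀ j < i, x j = y j) → ∀ j < i, H x j = H y j := by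
    intro i x y h j
    induction j using WellFoundedLT.induction with
    | ind j ih =>
      intro hj
      have h1 : (fun l (_ : l < j) => H x l) = fun l _ => H y l :=
        funext fun l => funext fun hl => ih l hl (hl.trans hj)
      have h2 : (fun l (_ : l < j) => x l) = fun l _ => y l :=
        funext fun l => funext fun hl => h l (hl.trans hj)
      rw [hH, hH, h1, h2, h j hj]
  have hGloc : ∀ i x y, (∀ j < i, x j = y j) → ∀ j < i, G x j = G y j := by
    intro i x y h j
    induction j using WellFoundedLT.induction with
    | ind j ih =>
      intro hj
      have h1 : (fun l (_ : l < j) => G x l) = fun l _ => G y l :=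
        funext fun l => funext fun hl => ih l hl (hl.trans hj)
      have h2 : (fun l (_ : l < j) => x l) = fun l _ => y l :=
        funext fun l => funext fun hl => h l (hl.trans hj)
      rw [hG, hG, h1, h2, h j hj]
  refine ⟨⟨H, G, hGH, hHG⟩, fun q => ?_, fun i x y => ⟨hHloc i x y, fun h j hj => ?_⟩⟩
  · funext i
    induction i using WellFoundedLT.induction with
    | ind i ih =>
      exact (hH (u q) i).trans (hE i _ _ q (fun _ _ => rfl) fun j hj => (ih j hj).symm)
  · rw [← hGH x, ← hGH y]
    exact hGloc i _ _ h j hj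

/-- In a well-order, the closure points of a function below `β` have a greatest element. -/
theorem exists_isGreatest_closurePoint {S : Type*} [LinearOrder S] [WellFoundedLT S]
    (f : S → S) (β : S) : ∃ c, IsGreatest {c | (∀ α < c, f α < c) ∧ c ≤ β} c := by
  have hne : (upperBounds {c | (∀ α < c, f α < c) ∧ c ≤ β}).Nonempty := ⟨β, fun c hc => hc.2⟩
  have wf : WellFounded ((· < ·) : S → S → Prop) := wellFounded_lt
  refine ⟨wf.min _ hne, ⟨fun α hα => ?_, ?_⟩, wf.min_mem _ hne⟩
  · have h : α ∉ upperBounds {c | (∀ α < c, f α < c) ∧ c ≤ β} := fun h => wf.not_lt_min _ h hα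
    simp only [mem_upperBounds, not_forall, not_le] at h
    obtain ⟨c, hc, hαc⟩ := h
    exact (hc.1 α hαc).trans_le (wf.min_mem _ hne hc)
  · exact wf.min_le fun c hc => hc.2

/-- Two families of branches of the binary tree of height `S` whose kernels have a common modulus
`f`, and which omit, above each of their nodes at height `α`, a node at height `f α`, are matched by
a permutation of all branches that is uniformly continuous in both directions. -/
theorem exists_uniform_perm {S Q : Type*} [LinearOrder S] [WellFoundedLT S]
    (u v : Q → S → Bool) (f : S → S) (e : S → S → S) (he : ∀ c, Injective (e c))
    (hce : ∀ c β, c ≤ e c β) (hef : ∀ c β, e c β ≤ f (max c β))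
    (hcof : ∀ β, ∃ c, (∀ α < c, f α < c) ∧ β ≤ c)
    (huv : ∀ α q q', (∀ β < f α, u q β = u q' β) → v q α = v q' α)
    (hvu : ∀ α q q', (∀ β < f α, v q β = v q' β) → u q α = u q' α)
    (hu : ∀ α q, ∃ s : S → Bool, (∀ β < α, s β = u q β) ∧ ∀ q', ¬ ∀ β < f α, u q' β = s β)
    (hv : ∀ α q, ∃ s : S → Bool, (∀ β < α, s β = v q β) ∧ ∀ q', ¬ ∀ β < f α, v q' β = s β) :
    ∃ H : (S → Bool) ≃ (S → Bool), (∀ q, H (u q) = v q) ∧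
      ∀ α, ∃ δ, ∀ x y, ((∀ β < δ, x β = y β) → ∀ β < α, H x β = H y β) ∧
        ((∀ β < δ, H x β = H y β) → ∀ β < α, x β = y β) := by
  classical
  choose p hp using exists_isGreatest_closurePoint f
  have hple : ∀ β, p β ≤ β := fun β => (hp β).1.2
  have hpmono : ∀ {a b}, a ≤ b → p a ≤ p b := fun {a b} hab =>
    (hp b).2 ⟨(hp a).1.1, (hple a).trans hab⟩
  have hpf : ∀ β, p (f β) ≤ p β := by
    intro β
    by_contra! hlt
    rcases lt_or_ge β (p (f β)) with h | h
    · exact ((hp (f β)).1.1 β h).not_ge (hple _)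
    · exact hlt.not_ge ((hp β).2 ⟨(hp (f β)).1.1, h⟩)
  have hpp : ∀ c, (∀ α < c, f α < c) → p c = c := fun c hc =>
    le_antisymm (hple c) ((hp c).2 ⟨hc, le_rfl⟩)
  have hplt : ∀ c, (∀ α < c, f α < c) → ∀ β, p β < c ↔ β < c := fun c hc β =>
    ⟨fun h => by
      by_contra! hcb
      exact h.not_ge (by simpa [hpp c hc] using hpmono hcb), fun h => (hple β).trans_lt h⟩
  have key : ∀ (w : Q → S → Bool) (_ : ∀ α q, ∃ s : S → Bool, (∀ β < α, s β = w q β) ∧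
      ∀ q', ¬ ∀ β < f α, w q' β = s β) (c : S) (_ : p c = c) (q : Q),
      ∃ g : ({β // p β = c} → Bool) → ({β // p β = c} → Bool), Injective g ∧
        ∀ a q', (∀ β < c, w q' β = w q β) → (fun β : {β // p β = c} => w q' β) ≠ g a := by
    intro w hw c hc q
    obtain ⟨s, hs, hsq⟩ := hw c q
    have hblock : ∀ β : {β // p β = c}, p (e (f c) β) = c := by
      rintro ⟨β, hβ⟩
      have hcb : c ≤ β := hβ ▸ hple β
      have hcf : c ≤ f c := by simpa using (hce c c).trans (hef c c)
      refine le_antisymm ((hpmono (hef _ _)).trans ((hpf _).trans ?_)) ?_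
      · rcases max_choice (f c) β with h | h <;> rw [h]
        exacts [(hpf c).trans hc.le, hβ.le]
      · exact hc.symm.le.trans (hpmono (hcf.trans (hce _ _)))
    refine ⟨fun a β => if (β : S) < f c then s β else
      if h : ∃ β' : {β // p β = c}, e (f c) β' = β then a h.choose else false, ?_, ?_⟩
    · intro a b hab
      funext β
      have h1 := congrFun hab ⟨e (f c) β, hblock β⟩
      have h2 : ∃ β' : {β // p β = c}, e (f c) β' = e (f c) β := ⟨β, rfl⟩
      have h3 : h2.choose = β := Subtype.ext (he _ h2.choose_spec)
      simpa only [if_neg (hce (f c) (β : S)).not_gt, dif_pos h2, h3] using h1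
    · intro a q' hq' hEq
      refine hsq q' fun β hβ => ?_
      rcases lt_or_ge β c with h | h
      · rw [hq' β h, hs β h]
      · have hb : p β = c := le_antisymm ((hpmono hβ.le).trans ((hpf c).trans hc.le))
          (hc.symm.le.trans (hpmono h))
        have := congrFun hEq ⟨β, hb⟩
        simpa only [if_pos hβ] using this
  let T : (S → Bool) ≃ (∀ i, {β // p β = i} → Bool) :=
    { toFun := fun x i β => x β
      invFun := fun a β => a (p β) ⟨β, rfl⟩
      left_inv := fun x => rfl
      right_inv := fun a => by
        funext i ⟨β, hβ⟩
        subst hβ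
        rfl }
  have hTle : ∀ (x y : S → Bool) i, (∀ j ≤ i, T x j = T y j) ↔ ∀ β, p β ≤ i → x β = y β := by
    intro x y i
    constructor
    · intro h β hβ
      exact congrFun (h (p β) hβ) ⟨β, rfl⟩
    · intro h j hj
      funext ⟨β, hβ⟩
      exact h β (hβ ▸ hj)
  have hTlt : ∀ (x y : S → Bool) i, (∀ j < i, T x j = T y j) ↔ ∀ β, p β < i → x β = y β := by
    intro x y i
    constructor
    · intro h β hβ
      exact congrFun (h (p β) hβ) ⟨β, rfl⟩
    · intro h j hj
      funext ⟨β, hβ⟩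
      exact h β (hβ ▸ hj)
  obtain ⟨H, hH, hHl⟩ := exists_level_preserving_perm (fun q => T (u q)) (fun q => T (v q))
    (by
      intro i q q'
      rw [hTle, hTle]
      constructor
      · exact fun h β hβ => huv β q q' fun γ hγ => h γ ((hpmono hγ.le).trans ((hpf β).trans hβ))
      · exact fun h β hβ => hvu β q q' fun γ hγ => h γ ((hpmono hγ.le).trans ((hpf β).trans hβ)))
    (by
      intro i q
      by_cases hi : p i = i
      · have hlt : ∀ β, p β < i ↔ β < i := hplt i (hi ▸ (hp i).1.1)
        have emb : ∀ w : Q → S → Bool, (∀ α q, ∃ s : S → Bool, (∀ β < α, s β = w q β) ∧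
            ∀ q', ¬ ∀ β < f α, w q' β = s β) →
            Nonempty (({β // p β = i} → Bool) ↪
              ↥(range fun q' : {q' // ∀ j < i, T (w q') j = T (w q) j} => T (w q') i)ᶜ) := by
          intro w hw
          obtain ⟨g, hg, hgw⟩ := key w hw i hi q
          refine ⟨⟨fun a => ⟨g a, ?_⟩, fun a b hab => hg (congrArg Subtype.val hab)⟩⟩
          rintro ⟨⟨q', hq'⟩, hEq⟩
          exact hgw a q' (fun β hβ => (hTlt _ _ i).1 hq' β ((hlt β).2 hβ)) hEq
        obtain ⟨eu⟩ := emb u hu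
        obtain ⟨ev⟩ := emb v hv
        exact ((Embedding.subtype _).trans ev).antisymm ((Embedding.subtype _).trans eu)
      · have : IsEmpty {β // p β = i} :=
          ⟨fun β => hi (β.2 ▸ hpp _ (hp _).1.1)⟩
        have hempty : ∀ w : Q → S → Bool,
            IsEmpty ↥(range fun q' : {q' // ∀ j < i, T (w q') j = T (w q) j} => T (w q') i)ᶜ :=
          fun w => ⟨fun a => a.2 ⟨⟨q, fun _ _ => rfl⟩, Subsingleton.elim _ _⟩⟩
        have := hempty u
        have := hempty v
        exact ⟨Equiv.equivOfIsEmpty _ _⟩)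
  refine ⟨T.trans (H.trans T.symm), fun q => by simp [hH], fun α => ?_⟩
  obtain ⟨c, hc, hαc⟩ := hcof α
  have hagree : ∀ x y : S → Bool, (∀ j < c, T x j = T y j) ↔ ∀ β < c, x β = y β := by
    intro x y
    simp only [hTlt, hplt c hc]
  refine ⟨c, fun x y => ?_⟩
  have h1 := hHl c (T x) (T y)
  rw [hagree, ← T.apply_symm_apply (H (T x)), ← T.apply_symm_apply (H (T y)), hagree] at h1
  exact ⟨fun h β hβ => h1.1 h β (hβ.trans_le hαc), fun h β hβ => h1.2 h β (hβ.trans_le hαc)⟩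

/-- If every two-colouring of pairs has an unbounded homogeneous set and short families are bounded,
then every `S`-sequence of branches of the binary tree of height `S` has a cluster point. -/
theorem exists_cluster_branch {S : Type*} [LinearOrder S] [WellFoundedLT S]
    (hram : ∀ f : S → S → Bool, ∃ (i : Bool) (A : Set S), (∀ s, ∃ a ∈ A, s < a) ∧
      ∀ a ∈ A, ∀ b ∈ A, a < b → f a b = i)
    (hbdd : ∀ (α : S) (g : Iio α → S), ∃ b, ∀ i, g i ≤ b) (x : S → S → Bool) :
    ∃ z : S → Bool, ∀ α δ, ∃ η, δ ≤ η ∧ ∀ β < α, x η β = z β := by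
  classical
  let lex : (S → Bool) → (S → Bool) → Prop := fun a b =>
    ∃ β, (∀ γ < β, a γ = b γ) ∧ a β = false ∧ b β = true
  have hlex : ∀ a b α, (∀ γ < α, a γ = b γ) → a α = true → b α = false → ¬ lex a b := by
    rintro a b α h ha hb ⟨β, hβ, haβ, hbβ⟩
    rcases lt_trichotomy α β with hlt | rfl | hlt
    · simpa [ha, hb] using hβ α hlt
    · simp [ha] at haβ
    · simpa [haβ, hbβ] using h β hlt
  obtain ⟨i, A, hA, hcol⟩ := hram fun a b => decide (lex (x a) (x b))
  have hconst : ∀ α, ∃ δ, ∀ a ∈ A, ∀ b ∈ A, δ ≤ a → δ ≤ b → x a α = x b α := by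
    intro α
    induction α using WellFoundedLT.induction with
    | ind α ih =>
      choose! d hd using ih
      obtain ⟨δ, hδ⟩ := hbdd α fun β => d β
      have hagree : ∀ a ∈ A, ∀ b ∈ A, δ ≤ a → δ ≤ b → ∀ β < α, x a β = x b β :=
        fun a ha b hb hda hdb β hβ =>
          hd β hβ a ha b hb ((hδ ⟨β, hβ⟩).trans hda) ((hδ ⟨β, hβ⟩).trans hdb)
      have hmono : ∀ a ∈ A, ∀ b ∈ A, δ ≤ a → a < b → x a α = i → x b α = i := by
        intro a ha b hb hda hab hai
        by_contra hbi
        have hag := hagree a ha b hb hda (hda.trans hab.le)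
        have hc := hcol a ha b hb hab
        cases i
        · rw [Bool.not_eq_false] at hbi
          exact of_decide_eq_false hc ⟨α, hag, hai, hbi⟩
        · rw [Bool.not_eq_true] at hbi
          exact hlex _ _ α hag hai hbi (of_decide_eq_true hc)
      by_cases hex : ∃ a ∈ A, δ ≤ a ∧ x a α = i
      · obtain ⟨a, ha, hda, hai⟩ := hex
        have hall : ∀ b ∈ A, a ≤ b → x b α = i := fun b hb hab => by
          rcases hab.eq_or_lt with rfl | hab
          exacts [hai, hmono a ha b hb hda hab hai]
        exact ⟨a, fun b hb c hc hab hac => (hall b hb hab).trans (hall c hc hac).symm⟩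
      · push Not at hex
        exact ⟨δ, fun b hb c hc hab hac => (Bool.eq_not_of_ne (hex b hb hab)).trans
          (Bool.eq_not_of_ne (hex c hc hac)).symm⟩
  choose d hd using hconst
  choose a ha hda using hA
  refine ⟨fun β => x (a (d β)) β, fun α δ => ?_⟩
  obtain ⟨b, hb⟩ := hbdd α fun β => d β
  refine ⟨a (max b δ), (le_max_right _ _).trans (hda _).le, fun β hβ => ?_⟩
  exact hd β _ (ha _) _ (ha _)
    (((hb ⟨β, hβ⟩).trans (le_max_left _ _)).trans (hda _).le) (hda _).le

/-- If every `c` has a successor-like bound and countable families are bounded, then the closure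
points of `f` are unbounded. -/
theorem exists_ge_closurePoint {S : Type*} [LinearOrder S] [WellFoundedLT S] [NoMaxOrder S]
    (hbdd : ∀ (α : S) (g : Iio α → S), ∃ b, ∀ i, g i ≤ b)
    (hω : ∀ g : ℕ → S, ∃ b, ∀ n, g n ≤ b) (f : S → S) (β : S) :
    ∃ c, (∀ α < c, f α < c) ∧ β ≤ c := by
  have hnext : ∀ x, ∃ y, ∀ α ≤ x, f α < y := by
    intro x
    obtain ⟨x', hx'⟩ := exists_gt x
    obtain ⟨b, hb⟩ := hbdd x' fun α => f α
    obtain ⟨y, hy⟩ := exists_gt b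
    exact ⟨y, fun α hα => (hb ⟨α, hα.trans_lt hx'⟩).trans_lt hy⟩
  choose nx hnx using hnext
  let g : ℕ → S := fun n => nx^[n] β
  have wf : WellFounded ((· < ·) : S → S → Prop) := wellFounded_lt
  have hne : (upperBounds (range g)).Nonempty := by
    obtain ⟨b, hb⟩ := hω g
    exact ⟨b, forall_mem_range.2 hb⟩
  have hub : ∀ n, g n ≤ wf.min _ hne := fun n => wf.min_mem _ hne (mem_range_self n)
  refine ⟨wf.min _ hne, fun α hα => ?_, hub 0⟩
  have h : α ∉ upperBounds (range g) := fun h => wf.not_lt_min _ h hα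
  simp only [mem_upperBounds, forall_mem_range, not_forall, not_le] at h
  obtain ⟨n, hn⟩ := h
  refine (hnx (g n) α hn.le).trans_le ?_
  simpa only [g, iterate_succ_apply'] using hub (n + 1)

/-- A subset of full cardinality is unbounded. -/
theorem exists_mem_gt_of_mk_eq {κ : Cardinal.{0}} {A : Set ↥(Set.Iio κ.ord)}
    (hA : Cardinal.mk A = Cardinal.lift.{1} κ) (s : ↥(Set.Iio κ.ord)) (hκ : Cardinal.aleph0 ≤ κ) :
    ∃ a ∈ A, s < a := by
  by_contra! h
  have hsucc : Order.succ (s : Ordinal) < κ.ord := (Cardinal.isSuccLimit_ord hκ).succ_lt s.2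
  have hle : Cardinal.mk A ≤ Cardinal.mk (Iio (Order.succ (s : Ordinal))) :=
    Cardinal.mk_le_of_injective (f := fun a : A => ⟨(a : Iio κ.ord),
      Order.lt_succ_iff.2 (show ((a : Iio κ.ord) : Ordinal) ≤ s from h a a.2)⟩)
      fun a b hab => Subtype.ext (Subtype.ext (Subtype.mk.inj hab))
  rw [hA, Cardinal.mk_Iio_ordinal, Cardinal.lift_le] at hle
  exact hle.not_gt (Cardinal.lt_ord.1 hsucc)

namespace WeaklyCompact

variable {κ : Cardinal.{0}}

theorem exists_homogeneous (hκ : WeaklyCompact κ)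
    (f : ↥(Set.Iio κ.ord) → ↥(Set.Iio κ.ord) → Bool) :
    ∃ (i : Bool) (A : Set ↥(Set.Iio κ.ord)), (∀ s, ∃ a ∈ A, s < a) ∧
      ∀ a ∈ A, ∀ b ∈ A, a < b → f a b = i := by
  obtain ⟨i, A, hA, h⟩ := hκ.2 f
  exact ⟨i, A, fun s => exists_mem_gt_of_mk_eq hA s hκ.1.le, h⟩

/-- Regularity of a weakly compact cardinal: families of fewer than `κ` ordinals below `κ` are
bounded below `κ`. -/
theorem exists_bound (hκ : WeaklyCompact κ) {I : Type 1} (hI : Cardinal.mk I < Cardinal.lift.{1} κ)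
    (g : I → ↥(Set.Iio κ.ord)) : ∃ b, ∀ i, g i ≤ b := by
  classical
  by_contra! hg
  choose r hr using hg
  obtain ⟨i, A, hA, h⟩ := hκ.2 fun a b => decide (r a = r b)
  cases i
  · have hinj : Injective fun a : A => r a := by
      intro a b hab
      by_contra hne
      rcases lt_or_gt_of_ne (fun h' => hne (Subtype.ext h') : (a : Iio κ.ord) ≠ b) with hlt | hlt
      · exact of_decide_eq_false (h a a.2 b b.2 hlt) hab
      · exact of_decide_eq_false (h b b.2 a a.2 hlt) hab.symm
    exact (hA.symm.le.trans (Cardinal.mk_le_of_injective hinj)).not_gt hI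
  · have hub := exists_mem_gt_of_mk_eq hA
    obtain ⟨a, ha, -⟩ := hub ⟨0, Cardinal.ord_pos.2 (Cardinal.aleph0_pos.trans hκ.1)⟩ hκ.1.le
    obtain ⟨b, hb, hab⟩ := hub (max a (g (r a))) hκ.1.le
    have : r a = r b := of_decide_eq_true (h a ha b hb ((le_max_left _ _).trans_lt hab))
    exact (hr b).not_gt (this ▸ (le_max_right _ _).trans_lt hab)

theorem exists_bound_Iio (hκ : WeaklyCompact κ) (α : ↥(Set.Iio κ.ord))
    (g : Iio α → ↥(Set.Iio κ.ord)) : ∃ b, ∀ i, g i ≤ b := by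
  refine hκ.exists_bound ?_ g
  refine (Cardinal.mk_le_of_injective (β := Iio (α : Ordinal))
    (f := fun a : Iio α => ⟨(a : Iio κ.ord), a.2⟩)
    fun a b hab => Subtype.ext (Subtype.ext (Subtype.mk.inj hab))).trans_lt ?_
  rw [Cardinal.mk_Iio_ordinal, Cardinal.lift_lt]
  exact Cardinal.lt_ord.1 α.2

theorem exists_bound_nat (hκ : WeaklyCompact κ) (g : ℕ → ↥(Set.Iio κ.ord)) :
    ∃ b, ∀ n, g n ≤ b := by
  obtain ⟨b, hb⟩ := hκ.exists_bound (I := ULift.{1} ℕ) (by simpa using hκ.1) fun n => g n.down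
  exact ⟨b, fun n => hb ⟨n⟩⟩

end WeaklyCompact

theorem mem_ball_cantorUltra_iff {κ : Cardinal.{0}} (hκ : Cardinal.aleph0 ≤ κ) {α : Ordinal}
    (hα : α < κ.ord) (x y : cantor κ) :
    y ∈ Ball (cantorUltra κ) α x ↔ ∀ β : ↥(Set.Iio κ.ord), (β : Ordinal) < α → x β = y β := by
  have hbdd : BddAbove {α : Ordinal | α < κ.ord ∧
      ∀ β : ↥(Set.Iio κ.ord), (β : Ordinal) < α → x β = y β} := ⟨κ.ord, fun _ h => h.1.le⟩
  refine ⟨fun h β hβ => ?_, fun h => le_csSup hbdd ⟨hα, h⟩⟩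
  have hne : {α : Ordinal | α < κ.ord ∧
      ∀ β : ↥(Set.Iio κ.ord), (β : Ordinal) < α → x β = y β}.Nonempty :=
    ⟨0, Cardinal.ord_pos.2 (Cardinal.aleph0_pos.trans_le hκ), fun β hβ => (not_lt_zero hβ).elim⟩
  obtain ⟨γ, hγ, hβγ⟩ := exists_lt_of_lt_csSup hne (hβ.trans_le h)
  exact hγ.2 β hβγ

theorem cantor_isOpen_iff {κ : Cardinal.{0}} (hκ : Cardinal.aleph0 ≤ κ) (U : Set (cantor κ)) :
    IsOpen U ↔ ∀ x ∈ U, ∃ α : ↥(Set.Iio κ.ord), ∀ y : cantor κ,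
      (∀ β < α, x β = y β) → y ∈ U := by
  have hpos : 0 < κ.ord := Cardinal.ord_pos.2 (Cardinal.aleph0_pos.trans_le hκ)
  constructor
  · intro hU
    induction hU with
    | basic s hs =>
      obtain ⟨c, α, hα, rfl⟩ := hs
      intro x hx
      refine ⟨⟨α, hα⟩, fun y hy => ?_⟩
      rw [mem_ball_cantorUltra_iff hκ hα] at hx ⊢
      exact fun β hβ => (hx β hβ).trans (hy β hβ)
    | univ => exact fun _ _ => ⟨⟨0, hpos⟩, fun _ _ => mem_univ _⟩
    | inter s t _ _ hs ht =>
      rintro x ⟨hxs, hxt⟩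
      obtain ⟨α, hα⟩ := hs x hxs
      obtain ⟨β, hβ⟩ := ht x hxt
      exact ⟨max α β, fun y hy => ⟨hα y fun γ hγ => hy γ (lt_max_of_lt_left hγ),
        hβ y fun γ hγ => hy γ (lt_max_of_lt_right hγ)⟩⟩
    | sUnion C _ hC =>
      rintro x ⟨s, hs, hxs⟩
      obtain ⟨α, hα⟩ := hC s hs x hxs
      exact ⟨α, fun y hy => ⟨s, hs, hα y hy⟩⟩
  · intro h
    have : Nonempty ↥(Set.Iio κ.ord) := ⟨⟨0, hpos⟩⟩
    choose! a ha using h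
    have hU : U = ⋃ x ∈ U, Ball (cantorUltra κ) (a x : Ordinal) x := by
      ext y
      simp only [mem_iUnion, exists_prop]
      constructor
      · exact fun hy => ⟨y, hy, (mem_ball_cantorUltra_iff hκ (a y).2 _ _).2 fun _ _ => rfl⟩
      · rintro ⟨x, hx, hy⟩
        exact ha x hx y fun β hβ => (mem_ball_cantorUltra_iff hκ (a x).2 _ _).1 hy β hβ
    rw [hU]
    exact isOpen_biUnion fun x _ =>
      TopologicalSpace.isOpen_generateFrom_of_mem ⟨x, a x, (a x).2, rfl⟩

/-- The set of points agreeing with `x` below `α` is open. -/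
theorem cantor_isOpen_agree {κ : Cardinal.{0}} (hκ : Cardinal.aleph0 ≤ κ) (x : cantor κ)
    (α : ↥(Set.Iio κ.ord)) : IsOpen {y : cantor κ | ∀ β < α, x β = y β} :=
  (cantor_isOpen_iff hκ _).2 fun _ hy => ⟨α, fun _ hz β hβ => (hy β hβ).trans (hz β hβ)⟩

theorem cantor_isOpen_apply_eq {κ : Cardinal.{0}} (hκ : Cardinal.aleph0 ≤ κ)
    (α : ↥(Set.Iio κ.ord)) (b : Bool) : IsOpen {y : cantor κ | y α = b} := by
  refine (cantor_isOpen_iff hκ _).2 fun y hy => ?_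
  refine ⟨⟨Order.succ α, (Cardinal.isSuccLimit_ord hκ).succ_lt α.2⟩, fun z hz => ?_⟩
  exact (hz α (Order.lt_succ (α : Ordinal))).symm.trans hy

theorem cantor_continuous {κ : Cardinal.{0}} (hκ : Cardinal.aleph0 ≤ κ) (F : cantor κ → cantor κ)
    (hF : ∀ α : ↥(Set.Iio κ.ord), ∃ δ : ↥(Set.Iio κ.ord), ∀ x y : cantor κ,
      (∀ β < δ, x β = y β) → ∀ β < α, F x β = F y β) : Continuous F := by
  refine continuous_def.2 fun U hU => (cantor_isOpen_iff hκ _).2 fun x hx => ?_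
  obtain ⟨α, hα⟩ := (cantor_isOpen_iff hκ U).1 hU (F x) hx
  obtain ⟨δ, hδ⟩ := hF α
  exact ⟨δ, fun y hy => hα _ (hδ x y hy)⟩

namespace WeaklyCompact

variable {κ : Cardinal.{0}}

/-- Closed subsets of `2^κ` are `κ`-compact: a neighbourhood assignment on a closed set has a
refinement by neighbourhoods of bounded index. -/
theorem exists_lebesgue_number (hκ : WeaklyCompact κ) {K : Set (cantor κ)} (hK : IsClosed K)
    (φ : K → ↥(Set.Iio κ.ord)) :
    ∃ δ, ∀ x : K, ∃ y : K, φ y ≤ δ ∧ ∀ β < φ y, y.1 β = x.1 β := by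
  by_contra! hcon
  choose x hx using hcon
  obtain ⟨z, hz⟩ := exists_cluster_branch hκ.exists_homogeneous hκ.exists_bound_Iio
    fun δ => (x δ).1
  have hzK : z ∈ K := by
    by_contra hzK
    obtain ⟨α, hα⟩ := (cantor_isOpen_iff hκ.1.le _).1 hK.isOpen_compl z hzK
    obtain ⟨η, -, hη⟩ := hz α α
    exact hα _ (fun β hβ => (hη β hβ).symm) (x η).2
  obtain ⟨η, hle, hη⟩ := hz (φ ⟨z, hzK⟩) (φ ⟨z, hzK⟩)
  obtain ⟨β, hβ, hne⟩ := hx η ⟨z, hzK⟩ hle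
  exact hne (hη β hβ).symm

/-- A continuous map from a closed subset of `2^κ` to `2^κ` is uniformly continuous. -/
theorem exists_modulus (hκ : WeaklyCompact κ) {K : Set (cantor κ)} (hK : IsClosed K)
    (g : K → cantor κ) (hg : Continuous g) (α : ↥(Set.Iio κ.ord)) :
    ∃ δ, ∀ x y : K, (∀ β < δ, x.1 β = y.1 β) → g x α = g y α := by
  have hφ : ∀ x : K, ∃ δ : ↥(Set.Iio κ.ord), ∀ y : K, (∀ β < δ, x.1 β = y.1 β) →
      g y α = g x α := by
    intro x
    obtain ⟨U, hU, hUg⟩ := isOpen_induced_iff.1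
      ((cantor_isOpen_apply_eq hκ.1.le α (g x α)).preimage hg)
    have hmem : ∀ y : K, y.1 ∈ U ↔ g y α = g x α := fun y => Set.ext_iff.1 hUg y
    obtain ⟨δ, hδ⟩ := (cantor_isOpen_iff hκ.1.le U).1 hU x ((hmem x).2 rfl)
    exact ⟨δ, fun y hy => (hmem y).1 (hδ y hy)⟩
  choose φ hφ using hφ
  obtain ⟨δ, hδ⟩ := hκ.exists_lebesgue_number hK φ
  refine ⟨δ, fun x y hxy => ?_⟩
  obtain ⟨w, hw, hwx⟩ := hδ x
  rw [hφ w x hwx, hφ w y fun β hβ => (hwx β hβ).trans (hxy β (hβ.trans_le hw))]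

/-- A closed nowhere dense subset of `2^κ` is uniformly nowhere dense at its own points. -/
theorem exists_omitted_node (hκ : WeaklyCompact κ) {K : Set (cantor κ)} (hK : IsClosed K)
    (hKn : IsNowhereDense K) (α : ↥(Set.Iio κ.ord)) :
    ∃ δ, ∀ x : K, ∃ s : cantor κ, (∀ β < α, s β = x.1 β) ∧
      ∀ y : K, ¬ ∀ β < δ, y.1 β = s β := by
  have hφ : ∀ x : K, ∃ δ : ↥(Set.Iio κ.ord), ∃ s : cantor κ, (∀ β < α, x.1 β = s β) ∧
      ∀ y : K, ¬ ∀ β < δ, s β = y.1 β := by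
    intro x
    have hnot : ¬ {y : cantor κ | ∀ β < α, x.1 β = y β} ⊆ K := by
      intro hsub
      have hx : x.1 ∈ interior (closure K) := mem_interior.2
        ⟨_, hsub.trans subset_closure, cantor_isOpen_agree hκ.1.le x.1 α, fun _ _ => rfl⟩
      rw [hKn] at hx
      exact hx
    obtain ⟨s, hs, hsK⟩ := not_subset.1 hnot
    obtain ⟨δ, hδ⟩ := (cantor_isOpen_iff hκ.1.le _).1 hK.isOpen_compl s hsK
    exact ⟨δ, s, hs, fun y hy => hδ y hy y.2⟩
  choose φ s hs hφ using hφ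
  obtain ⟨δ, hδ⟩ := hκ.exists_lebesgue_number hK fun x => max α (φ x)
  refine ⟨δ, fun x => ?_⟩
  obtain ⟨w, hw, hwx⟩ := hδ x
  refine ⟨s w, fun β hβ => (hs w β hβ).symm.trans (hwx β (lt_max_of_lt_left hβ)), fun y hy => ?_⟩
  exact hφ w y fun β hβ => (hy β (hβ.trans_le ((le_max_right _ _).trans hw))).symm

end WeaklyCompact

theorem stmt18 (κ : Cardinal.{0}) (hκ : WeaklyCompact κ)
    (K L : Set (cantor κ))
    (hKc : IsClosed K) (hKn : IsNowhereDense K)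
    (hLc : IsClosed L) (hLn : IsNowhereDense L)
    (h : ↥K ≃ₜ ↥L) :
    ∃ H : cantor κ ≃ₜ cantor κ, ∀ x : ↥K, H ↑x = ↑(h x) := by
  have hω : Cardinal.aleph0 ≤ κ := hκ.1.le
  have hadd : ∀ a b : ↥(Set.Iio κ.ord), (a : Ordinal) + b < κ.ord := fun a b =>
    (Ordinal.isPrincipal_add_ord hω) a.2 b.2
  have : NoMaxOrder ↥(Set.Iio κ.ord) :=
    ⟨fun a => ⟨⟨Order.succ a, (Cardinal.isSuccLimit_ord hω).succ_lt a.2⟩,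
      Order.lt_succ (a : Ordinal)⟩⟩
  let u : ↥K → ↥(Set.Iio κ.ord) → Bool := fun q => q.1
  let v : ↥K → ↥(Set.Iio κ.ord) → Bool := fun q => (h q).1
  choose f₁ hf₁ using hκ.exists_modulus hKc (fun q => (h q).1)
    (continuous_subtype_val.comp h.continuous)
  choose f₂ hf₂ using hκ.exists_modulus hLc (fun q => (h.symm q).1)
    (continuous_subtype_val.comp h.symm.continuous)
  choose f₃ hf₃ using hκ.exists_omitted_node hKc hKn
  choose f₄ hf₄ using hκ.exists_omitted_node hLc hLn
  let e : ↥(Set.Iio κ.ord) → ↥(Set.Iio κ.ord) → ↥(Set.Iio κ.ord) := fun a b => ⟨a + b, hadd a b⟩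
  let f : ↥(Set.Iio κ.ord) → ↥(Set.Iio κ.ord) := fun α =>
    max (max (f₁ α) (f₂ α)) (max (max (f₃ α) (f₄ α)) (e α α))
  have hf1 : ∀ α, f₁ α ≤ f α := fun α => by simp [f]
  have hf2 : ∀ α, f₂ α ≤ f α := fun α => by simp [f]
  have hf3 : ∀ α, f₃ α ≤ f α := fun α => by simp [f]
  have hf4 : ∀ α, f₄ α ≤ f α := fun α => by simp [f]
  have hf5 : ∀ α, e α α ≤ f α := fun α => by simp [f]
  obtain ⟨H, hH, hloc⟩ := exists_uniform_perm u v f e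
    (fun c a b hab => Subtype.ext (add_left_cancel (congrArg Subtype.val hab)))
    (fun c β => show (c : Ordinal) ≤ c + β from le_self_add)
    (fun c β => le_trans
      (show (c : Ordinal) + β ≤ (max c β : ↥(Set.Iio κ.ord)) + (max c β : ↥(Set.Iio κ.ord)) from
        add_le_add (le_max_left c β) (le_max_right c β)) (hf5 _))
    (exists_ge_closurePoint hκ.exists_bound_Iio hκ.exists_bound_nat f)
    (fun α q q' hq => hf₁ α q q' fun β hβ => hq β (hβ.trans_le (hf1 α)))
    (fun α q q' hq => by
      simpa [u] using hf₂ α (h q) (h q') fun β hβ => hq β (hβ.trans_le (hf2 α)))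
    (fun α q => by
      obtain ⟨s, hs, hsn⟩ := hf₃ α q
      exact ⟨s, hs, fun q' hq' => hsn q' fun β hβ => hq' β (hβ.trans_le (hf3 α))⟩)
    (fun α q => by
      obtain ⟨s, hs, hsn⟩ := hf₄ α (h q)
      exact ⟨s, hs, fun q' hq' => hsn (h q') fun β hβ => hq' β (hβ.trans_le (hf4 α))⟩)
  let E : cantor κ ≃ cantor κ := H
  refine ⟨⟨E, cantor_continuous hω _ fun α => ?_, cantor_continuous hω _ fun α => ?_⟩, hH⟩
  · obtain ⟨δ, hδ⟩ := hloc α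
    exact ⟨δ, fun x y => (hδ x y).1⟩
  · obtain ⟨δ, hδ⟩ := hloc α
    refine ⟨δ, fun x y hxy => (hδ (E.symm x) (E.symm y)).2 fun β hβ => ?_⟩
    have hx : H (E.symm x) = x := E.apply_symm_apply x
    have hy : H (E.symm y) = y := E.apply_symm_apply y
    rw [hx, hy]
    exact hxy β hβ
end
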